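/- (Bootstrap expansion (5.15), eq:boot-epsilon) In the functional random effects model under Assumption C, let (M₁,…,M_A) be a multinomially distributed random vector with parameters A and equal probabilities 1/A, independent of the data. Then sup_{t∈[0,1]} | A^{-1/2}·Σ_{i=1}^A (M_i − 1)·( X̄_{1,i,·}(t) − X̄_{2,i,·}(t) ) − A^{-1/2}·Σ_{i=1}^A (M_i − 1)·( ε_{1,i}(t) − ε_{2,i}(t) ) | → 0 in probability as A → ∞ and min_{i≤A} n_i → ∞. -/

import Mathlib

open MeasureTheory ProbabilityTheory Filter Topology

noncomputable section

/-- The unit interval `[0,1]` as a type. -/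
abbrev I01 : Type := Set.Icc (0:ℝ) 1

/-- The Banach space `C([0,1])` of continuous real-valued functions with the sup-norm. -/
abbrev CI : Type := C(I01, ℝ)

/-- The combined family of group-effect pairs and individual-effect pairs, used to state
joint independence in the functional random effects model. -/
def effFam {Ω : Type*} (ε1 ε2 : ℕ → Ω → CI) (η1 η2 : ℕ → ℕ → Ω → CI) :
    (ℕ ⊕ ℕ × ℕ) → Ω → CI × CI
  | Sum.inl i => fun ω => (ε1 i ω, ε2 i ω)
  | Sum.inr p => fun ω => (η1 p.1 p.2 ω, η2 p.1 p.2 ω)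

lemma dyadic_bound (g : ℝ → ℝ) (a : ℕ → ℝ) (b : ℝ) (h0 : |g 0| ≤ b) (ha : ∀ m, 0 ≤ a m)
    (hs : ∀ m k : ℕ, k < 2 ^ m → |g (((k:ℝ) + 1) / 2 ^ m) - g ((k:ℝ) / 2 ^ m)| ≤ a m) :
    ∀ m k : ℕ, k ≤ 2 ^ m → |g ((k:ℝ) / 2 ^ m)| ≤ b + ∑ l ∈ Finset.range (m + 1), a l := by
  intro m
  induction m with
  | zero =>
    intro k hk
    have h1 := hs 0 0 (by norm_num)
    have h2 := ha 0
    have : k = 0 ∨ k = 1 := by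
      simp at hk; omega
    rcases this with rfl | rfl
    · simp; linarith
    · simp at h1 ⊢
      have := abs_add_le (g 1 - g 0) (g 0)
      simp only [sub_add_cancel] at this
      linarith
  | succ m ih =>
    intro k hk
    rw [Finset.sum_range_succ]
    have h2 := ha (m+1)
    rcases Nat.even_or_odd' k with ⟨c, rfl | rfl⟩
    · have := ih c (by rw [pow_succ] at hk; omega)
      have e : (((2 * c : ℕ) : ℝ)) / 2 ^ (m+1) = (c:ℝ) / 2 ^ m := by
        push_cast; rw [pow_succ]; field_simp
      rw [e]; linarith
    · have := ih c (by rw [pow_succ] at hk; omega)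
      have e : (((2 * c : ℕ) : ℝ)) / 2 ^ (m+1) = (c:ℝ) / 2 ^ m := by
        push_cast; rw [pow_succ]; field_simp
      have h3 := hs (m+1) (2*c) (by omega)
      rw [e] at h3
      have h4 := abs_add_le (g ((((2 * c : ℕ) : ℝ) + 1) / 2 ^ (m+1)) - g ((c:ℝ) / 2 ^ m)) (g ((c:ℝ) / 2 ^ m))
      rw [sub_add_cancel] at h4
      have e2 : (((2 * c + 1 : ℕ) : ℝ)) = ((2 * c : ℕ) : ℝ) + 1 := by push_cast; ring
      rw [e2]
      linarith

/-- dyadic points in the unit interval -/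
def dy (m k : ℕ) : I01 := Set.projIcc (0:ℝ) 1 zero_le_one ((k:ℝ) / 2 ^ m)

lemma dy_zero : dy 0 0 = (0 : I01) := by
  unfold dy
  simp

lemma dy_dist (m k : ℕ) (hk : k < 2 ^ m) :
    |((dy m (k+1) : I01) : ℝ) - (dy m k : ℝ)| = (1/2) ^ m := by
  have hp : (0:ℝ) < 2 ^ m := by positivity
  have hk' : (k:ℝ) + 1 ≤ 2 ^ m := by exact_mod_cast hk
  have h1 : ((k:ℝ) / 2 ^ m) ∈ Set.Icc (0:ℝ) 1 := ⟨by positivity, by rw [div_le_one hp]; linarith⟩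
  have h2 : (((k+1:ℕ):ℝ) / 2 ^ m) ∈ Set.Icc (0:ℝ) 1 :=
    ⟨by positivity, by rw [div_le_one hp]; push_cast; linarith⟩
  unfold dy
  rw [Set.projIcc_of_mem _ h1, Set.projIcc_of_mem _ h2]
  simp only
  rw [← sub_div]
  push_cast
  rw [add_sub_cancel_left, abs_of_pos (by positivity)]
  simp

lemma chain_det (f : CI) (a : ℕ → ℝ) (b c : ℝ) (h0 : |f 0| ≤ b) (ha : ∀ m, 0 ≤ a m)
    (hac : ∀ m, ∑ l ∈ Finset.range m, a l ≤ c)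
    (hs : ∀ m k : ℕ, k < 2 ^ m → |f (dy m (k+1)) - f (dy m k)| ≤ a m) : ‖f‖ ≤ b + c := by
  have hbc : 0 ≤ b + c := by
    have := hac 0
    simp at this
    have := abs_nonneg (f 0)
    linarith
  rw [ContinuousMap.norm_le _ hbc]
  intro t
  set g : ℝ → ℝ := fun x => f (Set.projIcc (0:ℝ) 1 zero_le_one x) with hg
  have hgc : Continuous g := f.continuous.comp continuous_projIcc
  have key := dyadic_bound g a b (by simpa [hg] using h0) ha (by
    intro m k hk
    have := hs m k hk
    simpa [dy, hg] using this)
  have ht : g t = f t := by simp [hg]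
  have hlim : Tendsto (fun m : ℕ => |g ((⌊(t:ℝ) * 2 ^ m⌋₊ : ℝ) / 2 ^ m)|) atTop (𝓝 |g t|) := by
    have h1 := (tendsto_nat_floor_mul_div_atTop (R := ℝ) (a := (t:ℝ)) t.2.1).comp
      (tendsto_pow_atTop_atTop_of_one_lt (r := (2:ℝ)) (by norm_num))
    exact ((hgc.tendsto (t:ℝ)).comp h1).abs
  rw [Real.norm_eq_abs, ← ht]
  refine le_of_tendsto' hlim (fun m => ?_)
  have := key m ⌊(t:ℝ) * 2 ^ m⌋₊ (by
    apply Nat.floor_le_of_le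
    push_cast
    have := t.2.2
    have hp : (0:ℝ) < 2 ^ m := by positivity
    nlinarith)
  linarith [hac (m+1)]

lemma chain_prob (α : ℝ) (hα : 1 < α) : ∃ C : ℝ, 0 ≤ C ∧
    ∀ {Ω : Type*} [MeasurableSpace Ω] (P : Measure Ω) (F : Ω → CI) (B : ℝ), 0 ≤ B →
    (∀ a > 0, P {ω | a < |F ω 0|} ≤ ENNReal.ofReal (B / a ^ 4)) →
    (∀ s t : I01, ∀ a > 0, P {ω | a < |F ω s - F ω t|}
      ≤ ENNReal.ofReal (B * |(s:ℝ) - t| ^ α / a ^ 4)) →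
    ∀ δ > 0, P {ω | δ < ‖F ω‖} ≤ ENNReal.ofReal (C * B / δ ^ 4) := by
  set q : ℝ := (2:ℝ) ^ (1 - α) with hq
  have hq0 : 0 < q := by positivity
  have hq1 : q < 1 := Real.rpow_lt_one_of_one_lt_of_neg (by norm_num) (by linarith)
  set r : ℝ := q ^ ((1:ℝ)/8) with hr
  have hr0 : 0 < r := by positivity
  have hr1 : r < 1 := Real.rpow_lt_one hq0.le hq1 (by norm_num)
  have hrq : r ^ 8 = q := by
    rw [hr, ← Real.rpow_natCast, ← Real.rpow_mul hq0.le]; norm_num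
  have hr4 : r ^ 4 < 1 := pow_lt_one₀ hr0.le hr1 (by norm_num)
  have h2q : ∀ m : ℕ, (2:ℝ) ^ m * (((1:ℝ)/2) ^ m) ^ α = q ^ m := by
    intro m
    have e : q = 2 * ((1:ℝ)/2) ^ α := by
      rw [hq, Real.rpow_sub (by norm_num), Real.rpow_one, one_div, Real.inv_rpow (by norm_num)]
      ring
    rw [e, mul_pow]
    congr 1
    rw [← Real.rpow_natCast, ← Real.rpow_natCast, ← Real.rpow_mul (by norm_num),
      ← Real.rpow_mul (by norm_num), mul_comm]
  refine ⟨16 + 16 / (1 - r) ^ 4 * (1 - r ^ 4)⁻¹, ?_, ?_⟩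
  · have : 0 < 1 - r ^ 4 := by linarith
    have : 0 < 1 - r := by linarith
    positivity
  intro Ω _ P F B hB h0 hinc δ hδ
  have h1r : 0 < 1 - r := by linarith
  have h1r4 : 0 < 1 - r ^ 4 := by linarith
  set a : ℕ → ℝ := fun m => δ / 2 * (1 - r) * r ^ m with ha
  have hapos : ∀ m, 0 < a m := fun m => by simp only [ha]; positivity
  have hsub : {ω | δ < ‖F ω‖} ⊆ {ω | δ / 2 < |F ω 0|} ∪
      ⋃ m : ℕ, ⋃ k ∈ Finset.range (2 ^ m), {ω | a m < |F ω (dy m (k+1)) - F ω (dy m k)|} := by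
    intro ω hω
    by_contra hcon
    simp only [Set.mem_union, Set.mem_ofPred_eq, Set.mem_iUnion, Finset.mem_range, not_or, not_exists,
      not_lt] at hcon
    have := chain_det (F ω) a (δ/2) (δ/2) hcon.1 (fun m => (hapos m).le) (by
      intro m
      simp only [ha]
      rw [← Finset.mul_sum]
      have := geom_sum_mul_neg r m
      have h3 : 0 < r ^ m := by positivity
      calc δ / 2 * (1 - r) * ∑ i ∈ Finset.range m, r ^ i = δ / 2 * (1 - r ^ m) := by
            rw [← this]; ring
        _ ≤ δ / 2 := by nlinarith) (fun m k hk => hcon.2 m k hk)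
    simp only [Set.mem_ofPred_eq] at hω
    linarith
  have hlev : ∀ m : ℕ, P (⋃ k ∈ Finset.range (2 ^ m), {ω | a m < |F ω (dy m (k+1)) - F ω (dy m k)|})
      ≤ ENNReal.ofReal (16 / (1 - r) ^ 4 * B / δ ^ 4 * (r ^ 4) ^ m) := by
    intro m
    refine (measure_biUnion_finset_le _ _).trans ?_
    have : ∀ k ∈ Finset.range (2 ^ m), P {ω | a m < |F ω (dy m (k+1)) - F ω (dy m k)|}
        ≤ ENNReal.ofReal (B * (((1:ℝ)/2) ^ m) ^ α / (a m) ^ 4) := by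
      intro k hk
      have := hinc (dy m (k+1)) (dy m k) (a m) (hapos m)
      rwa [dy_dist m k (Finset.mem_range.mp hk)] at this
    refine (Finset.sum_le_sum this).trans ?_
    rw [Finset.sum_const, Finset.card_range, nsmul_eq_mul]
    have e2 : (((2 ^ m : ℕ)) : ENNReal) = ENNReal.ofReal ((2:ℝ) ^ m) := by
      rw [ENNReal.ofReal_pow (by norm_num)]; simp
    rw [e2, ← ENNReal.ofReal_mul (by positivity)]
    apply ENNReal.ofReal_le_ofReal
    have e3 : (2:ℝ) ^ m * (B * (((1:ℝ)/2) ^ m) ^ α / (a m) ^ 4)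
        = B * ((2:ℝ) ^ m * (((1:ℝ)/2) ^ m) ^ α) / (a m) ^ 4 := by ring
    rw [e3, h2q, ← hrq]
    apply le_of_eq
    simp only [ha]
    field_simp
    ring
  have hsum : HasSum (fun m : ℕ => 16 / (1 - r) ^ 4 * B / δ ^ 4 * (r ^ 4) ^ m)
      (16 / (1 - r) ^ 4 * B / δ ^ 4 * (1 - r ^ 4)⁻¹) :=
    (hasSum_geometric_of_lt_one (by positivity) hr4).mul_left _
  calc P {ω | δ < ‖F ω‖} ≤ _ := measure_mono hsub
    _ ≤ _ := measure_union_le _ _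
    _ ≤ ENNReal.ofReal (B / (δ/2) ^ 4) + ∑' m : ℕ,
        ENNReal.ofReal (16 / (1 - r) ^ 4 * B / δ ^ 4 * (r ^ 4) ^ m) :=
      add_le_add (h0 _ (by positivity)) ((measure_iUnion_le _).trans (ENNReal.tsum_le_tsum hlev))
    _ = ENNReal.ofReal ((16 + 16 / (1 - r) ^ 4 * (1 - r ^ 4)⁻¹) * B / δ ^ 4) := by
      rw [← ENNReal.ofReal_tsum_of_nonneg (fun m => by positivity) hsum.summable, hsum.tsum_eq,
        ← ENNReal.ofReal_add (by positivity) (by positivity)]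
      congr 1
      field_simp
      ring

lemma pow_int {Ω : Type*} [MeasurableSpace Ω] {P : Measure Ω} [IsProbabilityMeasure P]
    {f : Ω → ℝ} (hf : MemLp f 4 P) (k : ℕ) (hk : k ≤ 4) : Integrable (fun ω => f ω ^ k) P := by
  have h : MemLp f ((k : ℕ) : ENNReal) P := hf.mono_exponent (by exact_mod_cast hk)
  have h2 := h.integrable_norm_pow'
  refine (integrable_norm_iff (hf.1.pow k)).mp ?_
  simpa using! h2

lemma fourth {Ω ι : Type*} [MeasurableSpace Ω] {P : Measure Ω} [IsProbabilityMeasure P]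
    (Z : ι → Ω → ℝ) (hm : ∀ p, Measurable (Z p)) (hi : iIndepFun Z P) (h4 : ∀ p, MemLp (Z p) 4 P)
    (h0 : ∀ p, ∫ ω, Z p ω ∂P = 0) (u : ι → ℝ) (hu : ∀ p, 0 ≤ u p) (σ m : ℝ) (hσ : 0 ≤ σ)
    (hσm : σ ^ 2 ≤ m) (hZ2 : ∀ p, ∫ ω, Z p ω ^ 2 ∂P ≤ σ * u p)
    (hZ4 : ∀ p, ∫ ω, Z p ω ^ 4 ∂P ≤ m * u p ^ 2) (s : Finset ι) :
    MemLp (∑ p ∈ s, Z p) 4 P ∧ ∫ ω, (∑ p ∈ s, Z p) ω ∂P = 0 ∧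
    ∫ ω, (∑ p ∈ s, Z p) ω ^ 2 ∂P ≤ σ * ∑ p ∈ s, u p ∧
    ∫ ω, (∑ p ∈ s, Z p) ω ^ 4 ∂P ≤ 3 * m * (∑ p ∈ s, u p) ^ 2 := by
  classical
  induction s using Finset.induction_on with
  | empty => simp
  | insert p s hp ih =>
    obtain ⟨i4, i0, i2, i44⟩ := ih
    have hind := hi.indepFun_finsetSum_of_notMem hm hp
    have hSm : Measurable (∑ j ∈ s, Z j) := by
      have := Finset.measurable_sum s (fun i _ => hm i)
      convert this using 1
      ext ω; simp
    set S := ∑ j ∈ s, Z j with hS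
    set Y := Z p with hY
    rw [Finset.sum_insert hp, Finset.sum_insert hp, ← hS, ← hY, add_comm Y S]
    have hU : 0 ≤ ∑ j ∈ s, u j := Finset.sum_nonneg (fun j _ => hu j)
    set U := ∑ j ∈ s, u j with hUd
    have hc : ∀ a b : ℕ, a ≤ 4 → b ≤ 4 → Integrable (fun ω => S ω ^ a * Y ω ^ b) P ∧
        ∫ ω, S ω ^ a * Y ω ^ b ∂P = (∫ ω, S ω ^ a ∂P) * ∫ ω, Y ω ^ b ∂P := by
      intro a b ha hb
      have hab : IndepFun (fun ω => S ω ^ a) (fun ω => Y ω ^ b) P :=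
        hind.comp (φ := fun x => x ^ a) (ψ := fun x => x ^ b) (by fun_prop) (by fun_prop)
      exact ⟨hab.integrable_mul (pow_int i4 a ha) (pow_int (h4 p) b hb),
        hab.integral_fun_mul_eq_mul_integral (hSm.pow_const a).aestronglyMeasurable
          ((hm p).pow_const b).aestronglyMeasurable⟩
    have e11 := hc 1 1 (by norm_num) (by norm_num)
    have e31 := hc 3 1 (by norm_num) (by norm_num)
    have e13 := hc 1 3 (by norm_num) (by norm_num)
    have e22 := hc 2 2 (by norm_num) (by norm_num)
    have y0 : ∫ ω, Y ω ^ 1 ∂P = 0 := by simpa using h0 p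
    have s0 : ∫ ω, S ω ^ 1 ∂P = 0 := by simpa using i0
    have y2 := hZ2 p
    have y4 := hZ4 p
    rw [← hY] at y2 y4
    have S2 := pow_int i4 2 (by norm_num)
    have S4 := pow_int i4 4 (by norm_num)
    have Y2 := pow_int (h4 p) 2 (by norm_num)
    have Y4 := pow_int (h4 p) 4 (by norm_num)
    rw [← hY] at Y2 Y4
    have y2n : 0 ≤ ∫ ω, Y ω ^ 2 ∂P := integral_nonneg (fun ω => by positivity)
    have s2n : 0 ≤ ∫ ω, S ω ^ 2 ∂P := integral_nonneg (fun ω => by positivity)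
    refine ⟨i4.add (h4 p), ?_, ?_, ?_⟩
    · have := integral_add (i4.integrable (by norm_num)) ((h4 p).integrable (by norm_num))
      simp only [Pi.add_apply]
      rw [this, i0, ← hY, h0 p, add_zero]
    · have e : ∀ ω, (S + Y) ω ^ 2 = S ω ^ 2 + 2 * (S ω ^ 1 * Y ω ^ 1) + Y ω ^ 2 := by
        intro ω; simp only [Pi.add_apply]; ring
      simp only [e]
      have J1 : Integrable (fun ω => S ω ^ 2 + 2 * (S ω ^ 1 * Y ω ^ 1)) P := S2.add (e11.1.const_mul 2)
      rw [integral_add J1 Y2, integral_add S2 (e11.1.const_mul 2),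
        integral_const_mul, e11.2, y0]
      linarith
    · have e : ∀ ω, (S + Y) ω ^ 4 = S ω ^ 4 + 4 * (S ω ^ 3 * Y ω ^ 1) + 6 * (S ω ^ 2 * Y ω ^ 2)
          + 4 * (S ω ^ 1 * Y ω ^ 3) + Y ω ^ 4 := by
        intro ω; simp only [Pi.add_apply]; ring
      simp only [e]
      have I1 := e31.1.const_mul 4
      have I2 := e22.1.const_mul 6
      have I3 := e13.1.const_mul 4
      have J1 : Integrable (fun ω => S ω ^ 4 + 4 * (S ω ^ 3 * Y ω ^ 1)) P := S4.add I1
      have J2 : Integrable (fun ω => S ω ^ 4 + 4 * (S ω ^ 3 * Y ω ^ 1)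
          + 6 * (S ω ^ 2 * Y ω ^ 2)) P := J1.add I2
      have J3 : Integrable (fun ω => S ω ^ 4 + 4 * (S ω ^ 3 * Y ω ^ 1)
          + 6 * (S ω ^ 2 * Y ω ^ 2) + 4 * (S ω ^ 1 * Y ω ^ 3)) P := J2.add I3
      rw [integral_add J3 Y4, integral_add J2 I3, integral_add J1 I2, integral_add S4 I1, integral_const_mul, integral_const_mul,
        integral_const_mul, e31.2, e22.2, e13.2, y0, s0]
      have h6 : (∫ ω, S ω ^ 2 ∂P) * ∫ ω, Y ω ^ 2 ∂P ≤ (σ * U) * (σ * u p) :=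
        mul_le_mul i2 y2 y2n (by positivity)
      have hup := hu p
      have h7 : (σ * U) * (σ * u p) ≤ m * (U * u p) := by
        have : 0 ≤ U * u p := by positivity
        nlinarith
      have h8 : 0 ≤ m * u p ^ 2 := by
        have : 0 ≤ m := le_trans (by positivity) hσm
        positivity
      nlinarith

lemma four_ineq (y c : ℝ) : (y - c) ^ 4 ≤ 8 * y ^ 4 + 8 * c ^ 4 := by
  have h1 : (y - c) ^ 2 ≤ 2 * (y ^ 2 + c ^ 2) := by nlinarith [sq_nonneg (y + c)]
  have h2 := pow_le_pow_left₀ (sq_nonneg (y - c)) h1 2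
  have h3 := sq_nonneg (y ^ 2 - c ^ 2)
  have e : ((y - c) ^ 2) ^ 2 = (y - c) ^ 4 := by ring
  rw [e] at h2
  refine h2.trans ?_
  have e2 : (2 * (y ^ 2 + c ^ 2)) ^ 2 = 8 * y ^ 4 + 8 * c ^ 4 - 4 * (y ^ 2 - c ^ 2) ^ 2 := by ring
  rw [e2]
  linarith

lemma jens {Ω : Type*} [MeasurableSpace Ω] {P : Measure Ω} [IsProbabilityMeasure P]
    {g : Ω → ℝ} (h1 : Integrable g P) (h2 : Integrable (fun ω => g ω ^ 2) P) :
    (∫ ω, g ω ∂P) ^ 2 ≤ ∫ ω, g ω ^ 2 ∂P := by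
  set c := ∫ ω, g ω ∂P with hc
  have h : 0 ≤ ∫ ω, (g ω ^ 2 + ((-2 * c) * g ω + c ^ 2)) ∂P :=
    integral_nonneg (fun ω => by
      have : g ω ^ 2 + ((-2 * c) * g ω + c ^ 2) = (g ω - c) ^ 2 := by ring
      simp only [this, Pi.zero_apply]; positivity)
  have J : Integrable (fun ω => (-2 * c) * g ω + c ^ 2) P := (h1.const_mul _).add (integrable_const _)
  rw [integral_add h2 J, integral_add (h1.const_mul _) (integrable_const _), integral_const_mul,
    ← hc] at h
  simp at h
  nlinarith

lemma real_tail {Ω ι : Type*} [MeasurableSpace Ω] {P : Measure Ω} [IsProbabilityMeasure P]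
    (Y : ι → Ω → ℝ) (hm : ∀ p, Measurable (Y p)) (hi : iIndepFun Y P) (h4 : ∀ p, MemLp (Y p) 4 P)
    (c : ℝ) (hc : ∀ p, ∫ ω, Y p ω ∂P = c) (m : ℝ) (hm0 : 0 ≤ m)
    (hY4 : ∀ p, ∫ ω, Y p ω ^ 4 ∂P ≤ m) (s : Finset ι) (w : ι → ℝ) (a : ℝ) (ha : 0 < a) :
    P {ω | a < |∑ p ∈ s, w p * (Y p ω - c)|}
      ≤ ENNReal.ofReal (48 * m * (∑ p ∈ s, w p ^ 2) ^ 2 / a ^ 4) := by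
  have hR4 : ∀ p, MemLp (fun ω => Y p ω - c) 4 P := fun p => (h4 p).sub (memLp_const c)
  have hsq : ∀ f : Ω → ℝ, MemLp f 4 P → (∫ ω, f ω ^ 2 ∂P) ^ 2 ≤ ∫ ω, f ω ^ 4 ∂P := by
    intro f hf
    have e : ∀ ω, (f ω ^ 2) ^ 2 = f ω ^ 4 := fun ω => by ring
    have := jens (pow_int hf 2 (by norm_num)) (by simpa only [e] using pow_int hf 4 (by norm_num))
    simpa only [e] using this
  have hR : ∀ p, ∫ ω, (Y p ω - c) ^ 4 ∂P ≤ 16 * m := by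
    intro p
    have hc4 : c ^ 4 ≤ m := by
      have h1 := jens (by simpa using pow_int (h4 p) 1 (by norm_num)) (pow_int (h4 p) 2 (by norm_num))
      rw [hc] at h1
      have h2 := hsq _ (h4 p)
      have h3 : (c ^ 2) ^ 2 ≤ (∫ ω, Y p ω ^ 2 ∂P) ^ 2 := pow_le_pow_left₀ (by positivity) h1 2
      have h5 := hY4 p
      nlinarith
    have I4 := pow_int (h4 p) 4 (by norm_num)
    calc ∫ ω, (Y p ω - c) ^ 4 ∂P ≤ ∫ ω, (8 * Y p ω ^ 4 + 8 * c ^ 4) ∂P := by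
          apply integral_mono (pow_int (hR4 p) 4 (by norm_num))
            ((I4.const_mul 8).add (integrable_const _))
          intro ω
          simp only
          exact four_ineq _ _
      _ = 8 * ∫ ω, Y p ω ^ 4 ∂P + 8 * c ^ 4 := by
          rw [integral_add (I4.const_mul 8) (integrable_const _), integral_const_mul]; simp
      _ ≤ 16 * m := by linarith [hY4 p]
  have key := fourth (P := P) (fun p ω => w p * (Y p ω - c)) (fun p => by fun_prop)
    (hi.comp (fun p x => w p * (x - c)) (fun p => by fun_prop))
    (fun p => (hR4 p).const_mul (w p))
    (fun p => by
      rw [integral_const_mul, integral_sub ((h4 p).integrable (by norm_num)) (integrable_const _), hc]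
      simp)
    (fun p => w p ^ 2) (fun p => by positivity) (√(16 * m)) (16 * m) (by positivity)
    (by rw [Real.sq_sqrt (by positivity)])
    (fun p => by
      have := hsq _ (hR4 p)
      simp only [mul_pow]
      rw [integral_const_mul, mul_comm]
      gcongr
      apply Real.le_sqrt_of_sq_le
      exact this.trans (hR p))
    (fun p => by
      simp only [mul_pow]
      rw [integral_const_mul]
      have := hR p
      have hw : 0 ≤ w p ^ 4 := by positivity
      nlinarith) s
  obtain ⟨k4, -, -, kk⟩ := key
  have e : ∀ ω, (∑ p ∈ s, (fun ω => w p * (Y p ω - c))) ω = ∑ p ∈ s, w p * (Y p ω - c) := by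
    intro ω; simp
  have I := pow_int k4 4 (by norm_num)
  have mk := mul_meas_ge_le_integral_of_nonneg (μ := P)
    (f := fun ω => (∑ p ∈ s, (fun ω => w p * (Y p ω - c))) ω ^ 4)
    (Eventually.of_forall fun ω => by simp only [Pi.zero_apply]; positivity) I (a ^ 4)
  have hsub : {ω | a < |∑ p ∈ s, w p * (Y p ω - c)|}
      ⊆ {ω | a ^ 4 ≤ (∑ p ∈ s, (fun ω => w p * (Y p ω - c))) ω ^ 4} := by
    intro ω hω
    show a ^ 4 ≤ (∑ p ∈ s, (fun ω => w p * (Y p ω - c))) ω ^ 4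
    rw [e]
    have h1 : a ^ 4 ≤ |∑ p ∈ s, w p * (Y p ω - c)| ^ 4 :=
      pow_le_pow_left₀ ha.le (le_of_lt hω) 4
    rwa [Even.pow_abs (by decide)] at h1
  refine (measure_mono hsub).trans ?_
  rw [← ofReal_measureReal]
  apply ENNReal.ofReal_le_ofReal
  rw [le_div_iff₀ (by positivity)]
  linarith

lemma core {Ω ι : Type*} [MeasurableSpace Ω] (P : Measure Ω) [IsProbabilityMeasure P]
    [MeasurableSpace CI] [BorelSpace CI] (D : ι → Ω → CI) (hm : ∀ p, Measurable (D p))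
    (hi : iIndepFun D P) (p0 : ι) (hid : ∀ p, IdentDistrib (D p) (D p0) P P)
    (h4 : ∫⁻ ω, ENNReal.ofReal (‖D p0 ω‖ ^ ((4:ℝ))) ∂P < ⊤) (ϑ : ℝ) (hϑ : 1/4 < ϑ)
    (Mη : Ω → ℝ) (hMη0 : ∀ ω, 0 ≤ Mη ω)
    (hMη4 : ∫⁻ ω, ENNReal.ofReal (Mη ω ^ ((4:ℝ))) ∂P < ⊤)
    (hH : ∀ p, ∀ᵐ ω ∂P, ∀ s t : I01,
      |D p ω s - D p ω t| ≤ Mη ω * |(s : ℝ) - (t : ℝ)| ^ ϑ) :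
    ∃ K : ℝ, 0 ≤ K ∧ ∃ c : CI, ∀ (s : Finset ι) (w : ι → ℝ) (δ : ℝ), 0 < δ →
      P {ω | δ < ‖∑ p ∈ s, w p • (D p ω - c)‖}
        ≤ ENNReal.ofReal (K * (∑ p ∈ s, w p ^ 2) ^ 2 / δ ^ 4) := by
  obtain ⟨C, hC, hchain⟩ := chain_prob (4 * ϑ) (by linarith)
  have hL0 : MemLp (D p0) 4 P := by
    refine ⟨(hm p0).aestronglyMeasurable, ?_⟩
    rw [eLpNorm_lt_top_iff_lintegral_rpow_enorm_lt_top (by norm_num) (by norm_num)]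
    convert h4 using 3 with ω
    rw [← ofReal_norm, ENNReal.ofReal_rpow_of_nonneg (norm_nonneg _) (by norm_num)]
    norm_num
  have hL : ∀ p, MemLp (D p) 4 P := fun p => (hid p).symm.memLp_snd hL0
  have hcint := (hL p0).integrable (by norm_num)
  have hem : ∀ t : I01, Measurable (fun f : CI => f t) := fun t =>
    (continuous_eval_const t).measurable
  have hev : ∀ p (t : I01), MemLp (fun ω => D p ω t) 4 P := fun p t =>
    (hL p).mono ((hem t).comp (hm p)).aestronglyMeasurable
      (Eventually.of_forall fun ω => (D p ω).norm_coe_le_norm t)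
  set c : CI := ∫ ω, D p0 ω ∂P with hc
  have hct : ∀ p t, ∫ ω, D p ω t ∂P = c t := by
    intro p t
    rw [hc, ContinuousMap.integral_apply hcint]
    exact ((hid p).comp (hem t)).integral_eq
  set m0 : ℝ := ∫ ω, D p0 ω 0 ^ 4 ∂P with hm0
  have hm0n : 0 ≤ m0 := integral_nonneg fun ω => by positivity
  set m1 : ℝ := (∫⁻ ω, ENNReal.ofReal (Mη ω ^ ((4:ℝ))) ∂P).toReal with hm1
  have hm1n : 0 ≤ m1 := ENNReal.toReal_nonneg
  have hinc4 : ∀ p (s t : I01), ∫ ω, (D p ω s - D p ω t) ^ 4 ∂P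
      ≤ m1 * |(s:ℝ) - t| ^ (4 * ϑ) := by
    intro p s t
    have hx : 0 ≤ |(s:ℝ) - t| := abs_nonneg _
    have haes : AEStronglyMeasurable (fun ω => (D p ω s - D p ω t) ^ 4) P :=
      ((hev p s).sub (hev p t)).1.pow 4
    rw [integral_eq_lintegral_of_nonneg_ae (Eventually.of_forall fun ω => by
      simp only [Pi.zero_apply]; positivity) haes]
    have hle : ∫⁻ ω, ENNReal.ofReal ((D p ω s - D p ω t) ^ 4) ∂P
        ≤ ENNReal.ofReal (|(s:ℝ) - t| ^ (4 * ϑ)) * ∫⁻ ω, ENNReal.ofReal (Mη ω ^ ((4:ℝ))) ∂P := by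
      rw [← lintegral_const_mul' _ _ ENNReal.ofReal_ne_top]
      apply lintegral_mono_ae
      filter_upwards [hH p] with ω hω
      rw [← ENNReal.ofReal_mul (by positivity)]
      apply ENNReal.ofReal_le_ofReal
      have h1 := pow_le_pow_left₀ (abs_nonneg _) (hω s t) 4
      rw [Even.pow_abs (by decide), mul_pow] at h1
      refine h1.trans (le_of_eq ?_)
      rw [mul_comm, ← Real.rpow_natCast (|(s:ℝ) - t| ^ ϑ), ← Real.rpow_mul hx, ← Real.rpow_natCast]
      norm_num [mul_comm]
    have := ENNReal.toReal_mono (ENNReal.mul_ne_top ENNReal.ofReal_ne_top hMη4.ne) hle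
    rw [ENNReal.toReal_mul, ENNReal.toReal_ofReal (by positivity)] at this
    linarith
  refine ⟨C * (48 * (m0 + m1)), by positivity, c, ?_⟩
  intro s w δ hδ
  set W := ∑ p ∈ s, w p ^ 2 with hW
  have hmain := hchain P (fun ω => ∑ p ∈ s, w p • (D p ω - c)) (48 * (m0 + m1) * W ^ 2)
    (by positivity) ?_ ?_ δ hδ
  · refine hmain.trans (le_of_eq ?_)
    congr 1; ring
  · intro a ha
    have h := real_tail (P := P) (fun p ω => D p ω 0) (fun p => (hem 0).comp (hm p))
      (hi.comp (fun _ f => f 0) (fun _ => hem 0)) (fun p => hev p 0) (c 0) (fun p => hct p 0) m0 hm0n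
      (fun p => le_of_eq (((hid p).comp ((hem 0).pow_const 4)).integral_eq)) s w a ha
    have e : ∀ ω, (∑ p ∈ s, w p • (D p ω - c)) 0 = ∑ p ∈ s, w p * (D p ω 0 - c 0) := by
      intro ω; simp [ContinuousMap.sum_apply]
    simp only [e]
    refine h.trans (ENNReal.ofReal_le_ofReal ?_)
    gcongr
    linarith
  · intro x y a ha
    have h := real_tail (P := P) (fun p ω => D p ω x - D p ω y)
      (fun p => ((hem x).comp (hm p)).sub ((hem y).comp (hm p)))
      (hi.comp (fun _ f => f x - f y) (fun _ => (hem x).sub (hem y)))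
      (fun p => (hev p x).sub (hev p y)) (c x - c y)
      (fun p => by
        rw [integral_sub ((hev p x).integrable (by norm_num)) ((hev p y).integrable (by norm_num)),
          hct, hct])
      (m1 * |(x:ℝ) - y| ^ (4 * ϑ)) (by positivity) (fun p => hinc4 p x y) s w a ha
    have e : ∀ ω, (∑ p ∈ s, w p • (D p ω - c)) x - (∑ p ∈ s, w p • (D p ω - c)) y
        = ∑ p ∈ s, w p * ((D p ω x - D p ω y) - (c x - c y)) := by
      intro ω
      simp only [ContinuousMap.sum_apply, ContinuousMap.smul_apply, ContinuousMap.sub_apply,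
        smul_eq_mul, ← Finset.sum_sub_distrib]
      exact Finset.sum_congr rfl fun p _ => by ring
    simp only [e]
    refine h.trans (ENNReal.ofReal_le_ofReal ?_)
    have hx : 0 ≤ |(x:ℝ) - y| ^ (4 * ϑ) := by positivity
    have : 48 * (m1 * |(x:ℝ) - y| ^ (4 * ϑ)) * (∑ p ∈ s, w p ^ 2) ^ 2
        ≤ 48 * (m0 + m1) * W ^ 2 * |(x:ℝ) - y| ^ (4 * ϑ) := by
      rw [← hW]
      have : 0 ≤ 48 * m0 * W ^ 2 * |(x:ℝ) - y| ^ (4 * ϑ) := by positivity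
      nlinarith
    gcongr

/-- multinomial probability -/
def mprob (A : ℕ) (v : ℕ → ℕ) : ℝ :=
  ((A.factorial : ℝ) / (∏ i ∈ Finset.range A, ((v i).factorial : ℝ)) * ((A : ℝ)⁻¹) ^ A)

lemma mprob_nonneg (A : ℕ) (v : ℕ → ℕ) : 0 ≤ mprob A v := by unfold mprob; positivity

lemma mprob_gen (A : ℕ) (x : ℕ → ℝ) :
    ∑ v ∈ (Finset.range A).piAntidiag A, mprob A v * ∏ i ∈ Finset.range A, x i ^ v i
      = ((∑ i ∈ Finset.range A, x i) * (A:ℝ)⁻¹) ^ A := by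
  rw [mul_pow, Finset.sum_pow_eq_sum_piAntidiag, Finset.sum_mul]
  refine Finset.sum_congr rfl fun v hv => ?_
  have h := Nat.multinomial_spec (Finset.range A) v
  rw [(Finset.mem_piAntidiag.mp hv).1] at h
  have h' : (∏ i ∈ Finset.range A, ((v i).factorial : ℝ)) * (Nat.multinomial (Finset.range A) v : ℝ)
      = (A.factorial : ℝ) := by exact_mod_cast h
  have hp : (∏ i ∈ Finset.range A, ((v i).factorial : ℝ)) ≠ 0 :=
    Finset.prod_ne_zero_iff.mpr fun i _ => by positivity
  unfold mprob
  rw [← h', mul_div_cancel_left₀ _ hp]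
  ring

lemma mprob_sum (A : ℕ) (hA : 0 < A) : ∑ v ∈ (Finset.range A).piAntidiag A, mprob A v = 1 := by
  have := mprob_gen A (fun _ => 1)
  have hA' : (A:ℝ) ≠ 0 := by positivity
  simpa [hA'] using this

lemma sq_le_two_pow (m : ℕ) : ((m:ℝ) - 1) ^ 2 ≤ 2 ^ m := by
  induction m with
  | zero => norm_num
  | succ m ih =>
    rcases Nat.lt_or_ge m 4 with h | h
    · interval_cases m <;> norm_num
    · have : (4:ℝ) ≤ m := by exact_mod_cast h
      push_cast
      rw [pow_succ (2:ℝ) m, add_sub_cancel_right]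
      have h2 : (m:ℝ) ^ 2 ≤ 2 * ((m:ℝ) - 1) ^ 2 := by nlinarith
      linarith

lemma mprob_var (A : ℕ) (hA : 0 < A) (i : ℕ) (hi : i < A) :
    ∑ v ∈ (Finset.range A).piAntidiag A, mprob A v * ((v i : ℝ) - 1) ^ 2 ≤ Real.exp 1 := by
  have h := mprob_gen A (fun j => if j = i then 2 else 1)
  have hA' : (0:ℝ) < A := by positivity
  have e1 : ∑ j ∈ Finset.range A, (if j = i then (2:ℝ) else 1) = A + 1 := by
    have : ∀ j, (if j = i then (2:ℝ) else 1) = 1 + (if j = i then 1 else 0) := by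
      intro j; split_ifs <;> norm_num
    simp only [this, Finset.sum_add_distrib]
    simp [hi]
  rw [e1] at h
  have h2 : (((A:ℝ) + 1) * (A:ℝ)⁻¹) ^ A ≤ Real.exp 1 := by
    have h3 : ((A:ℝ) + 1) * (A:ℝ)⁻¹ ≤ Real.exp ((A:ℝ)⁻¹) := by
      have := Real.add_one_le_exp ((A:ℝ)⁻¹)
      have e : ((A:ℝ) + 1) * (A:ℝ)⁻¹ = (A:ℝ)⁻¹ + 1 := by field_simp; ring
      rwa [e]
    calc _ ≤ (Real.exp ((A:ℝ)⁻¹)) ^ A := pow_le_pow_left₀ (by positivity) h3 A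
      _ = Real.exp 1 := by rw [← Real.exp_nat_mul]; congr 1; field_simp
  refine le_trans ?_ (h.le.trans h2)
  refine Finset.sum_le_sum fun v _ => mul_le_mul_of_nonneg_left ?_ (mprob_nonneg A v)
  have : ∏ j ∈ Finset.range A, (if j = i then (2:ℝ) else 1) ^ v j = 2 ^ v i := by
    rw [Finset.prod_eq_single i]
    · simp
    · intro j _ hj; simp [hj]
    · intro hh; simp [hi] at hh
  rw [this]
  exact sq_le_two_pow _

/-- **Bootstrap expansion (5.15) in the functional random effects model.**
If `(M₁,…,M_A)` is multinomial with parameters `A` and equal probabilities `1/A`,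
independent of the data, then
`sup_t |A^{-1/2} Σ_i (M_i−1)(X̄_{1,i,·}(t)−X̄_{2,i,·}(t)) − A^{-1/2} Σ_i (M_i−1)(ε_{1,i}(t)−ε_{2,i}(t))| → 0`
in probability as `A → ∞` and `min_i n_i → ∞`. -/
theorem statement11 {Ω : Type*} [MeasurableSpace Ω] (P : Measure Ω) [IsProbabilityMeasure P]
    [MeasurableSpace CI] [BorelSpace CI]
    (μ1 μ2 : CI) (ε1 ε2 : ℕ → Ω → CI) (η1 η2 : ℕ → ℕ → Ω → CI)
    (hmeasε : ∀ i, Measurable (ε1 i) ∧ Measurable (ε2 i))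
    (hmeasη : ∀ i j, Measurable (η1 i j) ∧ Measurable (η2 i j))
    (hindep : iIndepFun (m := fun _ : ℕ ⊕ ℕ × ℕ => (inferInstance : MeasurableSpace (CI × CI)))
      (effFam ε1 ε2 η1 η2) P)
    (hidε : ∀ i, Measure.map (fun ω => (ε1 i ω, ε2 i ω)) P
      = Measure.map (fun ω => (ε1 0 ω, ε2 0 ω)) P)
    (hidη : ∀ i j, Measure.map (fun ω => (η1 i j ω, η2 i j ω)) P
      = Measure.map (fun ω => (η1 0 0 ω, η2 0 0 ω)) P)
    (hcentε : ∀ i (t : I01), (∫ ω, ε1 i ω t ∂P = 0) ∧ (∫ ω, ε2 i ω t ∂P = 0))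
    (hcentη : ∀ i j (t : I01), (∫ ω, η1 i j ω t ∂P = 0) ∧ (∫ ω, η2 i j ω t ∂P = 0))
    -- Assumption C for the differenced group effects
    (νε Kε : ℝ) (hνε : 0 < νε)
    (hmomε : ∀ i, ∫⁻ ω, ENNReal.ofReal (‖ε1 i ω - ε2 i ω‖ ^ ((2:ℝ) + νε)) ∂P
      ≤ ENNReal.ofReal Kε)
    (hmomε4 : ∀ i, ∫⁻ ω, ENNReal.ofReal (‖ε1 i ω - ε2 i ω‖ ^ ((4:ℝ))) ∂P < ⊤)
    (ϑ : ℝ) (hϑ : 1/4 < ϑ)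
    (Mε : Ω → ℝ) (hMε0 : ∀ ω, 0 ≤ Mε ω)
    (hMε4 : ∫⁻ ω, ENNReal.ofReal (Mε ω ^ ((4:ℝ))) ∂P < ⊤)
    (hHoldε : ∀ i, ∀ᵐ ω ∂P, ∀ s t : I01,
      |(ε1 i ω - ε2 i ω) s - (ε1 i ω - ε2 i ω) t| ≤ Mε ω * |(s : ℝ) - (t : ℝ)| ^ ϑ)
    -- Assumption C for the differenced individual effects
    (νη Kη : ℝ) (hνη : 0 < νη)
    (hmomη : ∀ i j, ∫⁻ ω, ENNReal.ofReal (‖η1 i j ω - η2 i j ω‖ ^ ((2:ℝ) + νη)) ∂P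
      ≤ ENNReal.ofReal Kη)
    (hmomη4 : ∀ i j, ∫⁻ ω, ENNReal.ofReal (‖η1 i j ω - η2 i j ω‖ ^ ((4:ℝ))) ∂P < ⊤)
    (Mη : Ω → ℝ) (hMη0 : ∀ ω, 0 ≤ Mη ω)
    (hMη4 : ∫⁻ ω, ENNReal.ofReal (Mη ω ^ ((4:ℝ))) ∂P < ⊤)
    (hHoldη : ∀ i j, ∀ᵐ ω ∂P, ∀ s t : I01,
      |(η1 i j ω - η2 i j ω) s - (η1 i j ω - η2 i j ω) t| ≤ Mη ω * |(s : ℝ) - (t : ℝ)| ^ ϑ)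
    -- sequences `A k → ∞`, `min_{i<A k} n k i → ∞`
    (A : ℕ → ℕ) (hApos : ∀ k, 0 < A k) (hA : Tendsto A atTop atTop)
    (n : ℕ → ℕ → ℕ) (hnpos : ∀ k i, 0 < n k i)
    (hmin : Tendsto (fun k => (Finset.range (A k)).inf'
      (Finset.nonempty_range_iff.mpr (hApos k).ne') (n k)) atTop atTop)
    -- multinomial weights `(M_1,…,M_A)` with parameters `A` and probabilities `1/A`,
    -- independent of the data
    (M : ℕ → ℕ → Ω → ℕ) (hMmeas : ∀ k i, Measurable (M k i))
    (hMlaw : ∀ k (v : ℕ → ℕ), (∑ i ∈ Finset.range (A k), v i = A k) →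
      P {ω | ∀ i < A k, M k i ω = v i}
        = ENNReal.ofReal (((A k).factorial : ℝ)
            / (∏ i ∈ Finset.range (A k), ((v i).factorial : ℝ)) * ((A k : ℝ)⁻¹) ^ (A k)))
    (hMindep : ∀ k, IndepFun (fun ω (i : ℕ) => M k i ω)
      (fun ω (s : ℕ ⊕ ℕ × ℕ) => effFam ε1 ε2 η1 η2 s ω) P) :
    ∀ δ > (0:ℝ),
      Tendsto (fun k => (P {ω | δ < ⨆ t : I01,
        |(Real.sqrt (A k))⁻¹ * ∑ i ∈ Finset.range (A k), ((M k i ω : ℝ) - 1) *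
            ((μ1 t + ε1 i ω t + (n k i : ℝ)⁻¹ * ∑ j ∈ Finset.range (n k i), η1 i j ω t)
              - (μ2 t + ε2 i ω t + (n k i : ℝ)⁻¹ * ∑ j ∈ Finset.range (n k i), η2 i j ω t))
          - (Real.sqrt (A k))⁻¹ * ∑ i ∈ Finset.range (A k), ((M k i ω : ℝ) - 1) *
            (ε1 i ω t - ε2 i ω t)|}).toReal)
        atTop (𝓝 0) := by
  classical
  intro δ hδ
  set ι : Type := Σ _ : ℕ, ℕ with hι
  have hinj : Function.Injective (fun p : ι => (Sum.inr (p.1, p.2) : ℕ ⊕ ℕ × ℕ)) := by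
    rintro ⟨a, b⟩ ⟨c, d⟩ h
    simp at h
    obtain ⟨rfl, rfl⟩ := h
    rfl
  have hsubm : Measurable (fun p : CI × CI => p.1 - p.2) := by fun_prop
  have hDi : iIndepFun (fun (p : ι) ω => η1 p.1 p.2 ω - η2 p.1 p.2 ω) P :=
    (hindep.precomp hinj).comp (fun _ q => q.1 - q.2) (fun _ => hsubm)
  obtain ⟨K, hK, c, hcore⟩ := core P (fun (p : ι) ω => η1 p.1 p.2 ω - η2 p.1 p.2 ω)
    (fun p => (hmeasη p.1 p.2).1.sub (hmeasη p.1 p.2).2) hDi ⟨0, 0⟩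
    (fun p => by
      have : IdentDistrib (fun ω => (η1 p.1 p.2 ω, η2 p.1 p.2 ω))
          (fun ω => (η1 0 0 ω, η2 0 0 ω)) P P :=
        ⟨((hmeasη _ _).1.prodMk (hmeasη _ _).2).aemeasurable,
          ((hmeasη _ _).1.prodMk (hmeasη _ _).2).aemeasurable, hidη _ _⟩
      exact this.comp hsubm)
    (hmomη4 0 0) ϑ hϑ Mη hMη0 hMη4
    (fun p => by simpa using hHoldη p.1 p.2)
  -- the minimal group size
  set N : ℕ → ℕ := fun k => (Finset.range (A k)).inf'
      (Finset.nonempty_range_iff.mpr (hApos k).ne') (n k) with hN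
  have hbound : ∀ k, (P {ω | δ < ⨆ t : I01,
        |(Real.sqrt (A k))⁻¹ * ∑ i ∈ Finset.range (A k), ((M k i ω : ℝ) - 1) *
            ((μ1 t + ε1 i ω t + (n k i : ℝ)⁻¹ * ∑ j ∈ Finset.range (n k i), η1 i j ω t)
              - (μ2 t + ε2 i ω t + (n k i : ℝ)⁻¹ * ∑ j ∈ Finset.range (n k i), η2 i j ω t))
          - (Real.sqrt (A k))⁻¹ * ∑ i ∈ Finset.range (A k), ((M k i ω : ℝ) - 1) *
            (ε1 i ω t - ε2 i ω t)|}).toReal ≤ √K / δ ^ 2 * Real.exp 1 * ((N k : ℝ))⁻¹ := by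
    intro k
    set B := {ω | δ < ⨆ t : I01,
        |(Real.sqrt (A k))⁻¹ * ∑ i ∈ Finset.range (A k), ((M k i ω : ℝ) - 1) *
            ((μ1 t + ε1 i ω t + (n k i : ℝ)⁻¹ * ∑ j ∈ Finset.range (n k i), η1 i j ω t)
              - (μ2 t + ε2 i ω t + (n k i : ℝ)⁻¹ * ∑ j ∈ Finset.range (n k i), η2 i j ω t))
          - (Real.sqrt (A k))⁻¹ * ∑ i ∈ Finset.range (A k), ((M k i ω : ℝ) - 1) *
            (ε1 i ω t - ε2 i ω t)|} with hB
    set V := (Finset.range (A k)).piAntidiag (A k) with hV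
    have hAk : (0:ℝ) < A k := by exact_mod_cast hApos k
    have hNpos : 0 < N k := by
      simp only [hN]
      rw [Finset.lt_inf'_iff]
      exact fun i _ => hnpos k i
    have hNle : ∀ i ∈ Finset.range (A k), N k ≤ n k i := fun i hi => Finset.inf'_le _ hi
    set E : (ℕ → ℕ) → Set Ω := fun v => {ω | ∀ i < A k, M k i ω = v i} with hE
    set T : (ℕ → ℕ) → Set (ℕ → ℕ) := fun v => {m | ∀ i < A k, m i = v i} with hT
    have hTm : ∀ v, MeasurableSet (T v) := by
      intro v
      have : T v = ⋂ i : ℕ, ⋂ _ : i < A k, (fun m : ℕ → ℕ => m i) ⁻¹' {v i} := by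
        ext m; simp [hT]
      rw [this]
      exact MeasurableSet.iInter fun i => MeasurableSet.iInter fun _ =>
        measurable_pi_apply i (measurableSet_singleton _)
    have hEm : ∀ v, MeasurableSet (E v) := fun v =>
      (measurable_pi_lambda (fun ω (i : ℕ) => M k i ω) (fun i => hMmeas k i)) (hTm v)
    have hEp : ∀ v ∈ V, P (E v) = ENNReal.ofReal (mprob (A k) v) := fun v hv =>
      hMlaw k v (Finset.mem_piAntidiag.mp hv).1
    have hdisj : (V : Set (ℕ → ℕ)).PairwiseDisjoint E := by
      intro v hv v' hv' hne
      rw [Function.onFun, Set.disjoint_left]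
      intro ω h1 h2
      apply hne
      funext i
      by_cases hi : i < A k
      · rw [← h1 i hi, ← h2 i hi]
      · have q1 := (Finset.mem_piAntidiag.mp hv).2 i
        have q2 := (Finset.mem_piAntidiag.mp hv').2 i
        simp only [Finset.mem_range] at q1 q2
        have r1 : v i = 0 := by by_contra h; exact hi (q1 h)
        have r2 : v' i = 0 := by by_contra h; exact hi (q2 h)
        rw [r1, r2]
    have hfull : P (⋃ v ∈ V, E v) = 1 := by
      rw [measure_biUnion_finset hdisj (fun v _ => hEm v), Finset.sum_congr rfl hEp,
        ← ENNReal.ofReal_sum_of_nonneg (fun v _ => mprob_nonneg _ _), mprob_sum _ (hApos k)]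
      simp
    have hnull : P (⋃ v ∈ V, E v)ᶜ = 0 :=
      (prob_compl_eq_zero_iff (Finset.measurableSet_biUnion V fun v _ => hEm v)).mpr hfull
    set s : Finset ι := (Finset.range (A k)).sigma (fun i => Finset.range (n k i)) with hs
    set w : (ℕ → ℕ) → ι → ℝ := fun v p =>
      (Real.sqrt (A k))⁻¹ * ((v p.1 : ℝ) - 1) * (n k p.1 : ℝ)⁻¹ with hw
    set S : (ℕ → ℕ) → Ω → CI := fun v ω =>
      ∑ p ∈ s, w v p • (η1 p.1 p.2 ω - η2 p.1 p.2 ω - c) with hS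
    have hpath : ∀ v ∈ V, ∀ ω ∈ E v, ω ∈ B → δ < ‖S v ω‖ := by
      intro v hv ω hω hωB
      refine lt_of_lt_of_le hωB ?_
      refine ciSup_le fun t => ?_
      refine le_trans (le_of_eq ?_) ((S v ω).norm_coe_le_norm t)
      rw [Real.norm_eq_abs]
      congr 1
      have hsum : ∑ i ∈ Finset.range (A k), ((v i : ℝ) - 1) = 0 := by
        have := (Finset.mem_piAntidiag.mp hv).1
        rw [Finset.sum_sub_distrib, ← Nat.cast_sum, this]
        simp
      have e1 : S v ω t = ∑ i ∈ Finset.range (A k), ((Real.sqrt (A k))⁻¹ * ((v i : ℝ) - 1) *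
          ((n k i : ℝ)⁻¹ * ∑ j ∈ Finset.range (n k i), η1 i j ω t
            - (n k i : ℝ)⁻¹ * ∑ j ∈ Finset.range (n k i), η2 i j ω t - c t)) := by
        simp only [hS, hs, hw, ContinuousMap.sum_apply, ContinuousMap.smul_apply,
          ContinuousMap.sub_apply, smul_eq_mul]
        rw [Finset.sum_sigma]
        refine Finset.sum_congr rfl fun i _ => ?_
        simp only
        rw [← Finset.mul_sum, Finset.sum_sub_distrib, Finset.sum_sub_distrib]
        have : (n k i : ℝ) ≠ 0 := by exact_mod_cast (hnpos k i).ne'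
        simp only [Finset.sum_const, Finset.card_range, nsmul_eq_mul]
        field_simp
      have e2 : (Real.sqrt (A k))⁻¹ * (μ1 t - μ2 t + c t)
          * ∑ i ∈ Finset.range (A k), ((v i : ℝ) - 1) = 0 := by rw [hsum, mul_zero]
      rw [← sub_eq_zero, e1]
      refine Eq.trans ?_ e2
      rw [Finset.mul_sum, Finset.mul_sum, Finset.mul_sum,
        ← Finset.sum_sub_distrib, ← Finset.sum_sub_distrib]
      refine Finset.sum_congr rfl fun i hi => ?_
      rw [hω i (Finset.mem_range.mp hi)]
      ring
    have hsub : B ⊆ (⋃ v ∈ V, E v)ᶜ ∪ ⋃ v ∈ V, (E v ∩ {ω | δ < ‖S v ω‖}) := by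
      intro ω hωB
      by_cases h : ω ∈ ⋃ v ∈ V, E v
      · right
        simp only [Set.mem_iUnion] at h ⊢
        obtain ⟨v, hv, hω⟩ := h
        exact ⟨v, hv, hω, hpath v hv ω hω hωB⟩
      · exact Or.inl h
    have hindv : ∀ v, P (E v ∩ {ω | δ < ‖S v ω‖}) = P (E v) * P {ω | δ < ‖S v ω‖} := by
      intro v
      have hΦ : Measurable (fun d : (ℕ ⊕ ℕ × ℕ) → CI × CI =>
          ‖∑ p ∈ s, w v p • ((d (Sum.inr (p.1, p.2))).1 - (d (Sum.inr (p.1, p.2))).2 - c)‖) := by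
        apply Measurable.norm
        refine Finset.measurable_sum s fun p _ => ?_
        have h1 : Measurable (fun d : (ℕ ⊕ ℕ × ℕ) → CI × CI =>
            (d (Sum.inr (p.1, p.2))).1 - (d (Sum.inr (p.1, p.2))).2 - c) :=
          (hsubm.comp (measurable_pi_apply _)).sub_const c
        exact h1.const_smul (w v p)
      exact (hMindep k).measure_inter_preimage_eq_mul (T v) _ (hTm v) (hΦ measurableSet_Ioi)
    set Q : (ℕ → ℕ) → ℝ := fun v => ∑ p ∈ s, w v p ^ 2 with hQ
    have hQ0 : ∀ v, 0 ≤ Q v := fun v => Finset.sum_nonneg fun p _ => by positivity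
    have htail : ∀ v, P {ω | δ < ‖S v ω‖} ≤ ENNReal.ofReal (√K * Q v / δ ^ 2) := by
      intro v
      have h := hcore s (w v) δ hδ
      have hp : P.real {ω | δ < ‖S v ω‖} ≤ K * (Q v) ^ 2 / δ ^ 4 :=
        ENNReal.toReal_le_of_le_ofReal (by positivity) h
      rw [← ofReal_measureReal]
      apply ENNReal.ofReal_le_ofReal
      have h1 : P.real {ω | δ < ‖S v ω‖} ≤ 1 := measureReal_le_one
      have h0 : 0 ≤ P.real {ω | δ < ‖S v ω‖} := measureReal_nonneg
      have hq := hQ0 v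
      refine (fun h hb => (pow_le_pow_iff_left₀ h0 hb (two_ne_zero)).mp h : _ → (0:ℝ) ≤ √K * Q v / δ ^ 2 → _) ?_ (by positivity)
      have e : (√K * Q v / δ ^ 2) ^ 2 = K * (Q v) ^ 2 / δ ^ 4 := by
        rw [div_pow, mul_pow, Real.sq_sqrt hK]; ring
      rw [e]
      nlinarith
    have hQle : ∀ v, Q v ≤ (A k : ℝ)⁻¹ * (N k : ℝ)⁻¹ *
        ∑ i ∈ Finset.range (A k), ((v i : ℝ) - 1) ^ 2 := by
      intro v
      simp only [hQ, hs, hw]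
      rw [Finset.sum_sigma, Finset.mul_sum]
      refine Finset.sum_le_sum fun i hi => ?_
      simp only [Finset.sum_const, Finset.card_range, nsmul_eq_mul]
      have hn0 : (0:ℝ) < n k i := by exact_mod_cast hnpos k i
      have hN0 : (0:ℝ) < N k := by exact_mod_cast hNpos
      have hNn : (N k : ℝ) ≤ n k i := by exact_mod_cast hNle i hi
      have e : (n k i : ℝ) * ((Real.sqrt (A k))⁻¹ * ((v i : ℝ) - 1) * (n k i : ℝ)⁻¹) ^ 2
          = (A k : ℝ)⁻¹ * (n k i : ℝ)⁻¹ * ((v i : ℝ) - 1) ^ 2 := by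
        rw [mul_pow, mul_pow, inv_pow, Real.sq_sqrt hAk.le]
        field_simp
      rw [e]
      gcongr
    have hfinal : P B ≤ ENNReal.ofReal (√K / δ ^ 2 * Real.exp 1 * ((N k : ℝ))⁻¹) := by
      calc P B ≤ _ := measure_mono hsub
        _ ≤ _ := measure_union_le _ _
        _ ≤ 0 + ∑ v ∈ V, ENNReal.ofReal (mprob (A k) v * (√K * Q v / δ ^ 2)) := by
          refine add_le_add hnull.le ((measure_biUnion_finset_le _ _).trans ?_)
          refine Finset.sum_le_sum fun v hv => ?_
          rw [hindv, hEp v hv, ENNReal.ofReal_mul (mprob_nonneg _ _)]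
          gcongr
          exact htail v
        _ ≤ _ := by
          rw [zero_add, ← ENNReal.ofReal_sum_of_nonneg (fun v _ => by
            have := mprob_nonneg (A k) v
            have := hQ0 v
            positivity)]
          apply ENNReal.ofReal_le_ofReal
          calc ∑ v ∈ V, mprob (A k) v * (√K * Q v / δ ^ 2)
              ≤ ∑ v ∈ V, ∑ i ∈ Finset.range (A k), (√K / δ ^ 2 * ((A k : ℝ)⁻¹ * (N k : ℝ)⁻¹)) *
                (mprob (A k) v * ((v i : ℝ) - 1) ^ 2) := by
                refine Finset.sum_le_sum fun v _ => ?_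
                rw [← Finset.mul_sum, ← Finset.mul_sum]
                have := mprob_nonneg (A k) v
                calc mprob (A k) v * (√K * Q v / δ ^ 2) = mprob (A k) v * (√K / δ ^ 2) * Q v := by ring
                  _ ≤ mprob (A k) v * (√K / δ ^ 2) * ((A k : ℝ)⁻¹ * (N k : ℝ)⁻¹ *
                      ∑ i ∈ Finset.range (A k), ((v i : ℝ) - 1) ^ 2) :=
                    mul_le_mul_of_nonneg_left (hQle v) (by positivity)
                  _ = _ := by ring
            _ = ∑ i ∈ Finset.range (A k), (√K / δ ^ 2 * ((A k : ℝ)⁻¹ * (N k : ℝ)⁻¹)) *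
                ∑ v ∈ V, (mprob (A k) v * ((v i : ℝ) - 1) ^ 2) := by
                rw [Finset.sum_comm]
                simp only [Finset.mul_sum]
            _ ≤ ∑ i ∈ Finset.range (A k), (√K / δ ^ 2 * ((A k : ℝ)⁻¹ * (N k : ℝ)⁻¹)) * Real.exp 1 := by
                refine Finset.sum_le_sum fun i hi => ?_
                exact mul_le_mul_of_nonneg_left (mprob_var _ (hApos k) i (Finset.mem_range.mp hi))
                  (by positivity)
            _ = √K / δ ^ 2 * Real.exp 1 * ((N k : ℝ))⁻¹ := by
                rw [Finset.sum_const, Finset.card_range, nsmul_eq_mul]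
                field_simp
    exact ENNReal.toReal_le_of_le_ofReal (by positivity) hfinal
  have hlim : Tendsto (fun k => √K / δ ^ 2 * Real.exp 1 * ((N k : ℝ))⁻¹) atTop (𝓝 0) := by
    have := (tendsto_inv_atTop_zero.comp ((tendsto_natCast_atTop_atTop (R := ℝ)).comp hmin)).const_mul
      (√K / δ ^ 2 * Real.exp 1)
    simpa using! this
  exact squeeze_zero (fun k => ENNReal.toReal_nonneg) hbound hlim
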